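/- The function g : [0,∞) → ℝ given by g(T) = I(X₁,X₂,X₃,X₄; Y₁,Y₂,Y₃,Y₄), where the times are set to T₁ = T₂ = T₃ = T₄ = T/4 and all other times are 0, is concave on [0,∞). -/

import Mathlib

open MeasureTheory ProbabilityTheory Real Filter

noncomputable section

/-- Shannon entropy of a measure: the sum of `-q * log q` over the normalized
masses of singletons (Mathlib-style `measureEntropy`). -/
def measureEntropy {S : Type*} [MeasurableSpace S] (μ : Measure S) : ℝ :=
  ∑' s, Real.negMulLog (((μ Set.univ)⁻¹ • μ) {s}).toReal

/-- Mutual information of a joint law on a product space: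
`I(X;Y) = H(X) + H(Y) - H(X,Y)`. -/
def measureMutualInfo {S U : Type*} [MeasurableSpace S] [MeasurableSpace U]
    (μ : Measure (S × U)) : ℝ :=
  measureEntropy (μ.map Prod.fst) + measureEntropy (μ.map Prod.snd) - measureEntropy μ

/-- The 15 nonempty subsets of `{1,2,3,4}` (coded as `Fin 4`), in the paper's order:
`S₁={1}, S₂={2}, S₃={3}, S₄={4}, S₅={1,2}, S₆={1,3}, S₇={1,4}, S₈={2,3}, S₉={2,4},
S₁₀={3,4}, S₁₁={1,2,3}, S₁₂={1,2,4}, S₁₃={1,3,4}, S₁₄={2,3,4}, S₁₅={1,2,3,4}`. -/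
def sens : Fin 15 → Finset (Fin 4) :=
  ![{0}, {1}, {2}, {3}, {0,1}, {0,2}, {0,3}, {1,2}, {1,3}, {2,3},
    {0,1,2}, {0,1,3}, {0,2,3}, {1,2,3}, {0,1,2,3}]

/-- Law of one input component: `λ₁` with probability `p`, `λ₀` with probability `1-p`. -/
def inputLaw (p lam0 lam1 : ℝ) : Measure ℝ :=
  ENNReal.ofReal p • Measure.dirac lam1 + ENNReal.ofReal (1 - p) • Measure.dirac lam0

/-- Law of the input vector `X = (X₁,X₂,X₃,X₄)` with i.i.d. components. -/
def XLaw (p lam0 lam1 : ℝ) : Measure (Fin 4 → ℝ) :=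
  Measure.pi fun _ => inputLaw p lam0 lam1

/-- Poisson distribution on `ℕ` with (nonnegative) real rate `r`;
rate `0` gives the Dirac mass at `0`. -/
def poissonMeasure (r : ℝ) : Measure ℕ :=
  (poissonPMF r.toNNReal).toMeasure

/-- Joint law of `(X, (Y_{idx 1}, …, Y_{idx k}))` in the vector Poisson channel:
conditionally on `X = x`, the indicated outputs are independent with
`Y_i ~ Poisson (T i * ∑_{j ∈ Sᵢ} x j)`. -/
def poissonJointLaw (p lam0 lam1 : ℝ) (T : Fin 15 → ℝ) {k : ℕ} (idx : Fin k → Fin 15) :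
    Measure ((Fin 4 → ℝ) × (Fin k → ℕ)) :=
  (XLaw p lam0 lam1).bind fun x =>
    (Measure.pi fun i => poissonMeasure (T (idx i) * ∑ j ∈ sens (idx i), x j)).map
      (fun y => (x, y))

theorem convexOn_Ici_of_continuousOn_of_midpoint {f : ℝ → ℝ}
    (hf : ContinuousOn f (Set.Ici 0))
    (hmid : ∀ a h, 0 ≤ a → 0 < h → 2 * f (a + h) ≤ f a + f (a + h + h)) :
    ConvexOn ℝ (Set.Ici 0) f := by
  refine LinearOrder.convexOn_of_lt (convex_Ici 0) ?_
  intro x hx y hy hxy a b ha hb hab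
  have hx0 : (0 : ℝ) ≤ x := hx
  have hyx : 0 < y - x := sub_pos.2 hxy
  set m : ℝ := (f y - f x) / (y - x) with hm
  have hm' : m * (y - x) = f y - f x := div_mul_cancel₀ _ hyx.ne'
  set φ : ℝ → ℝ := fun z => f z - (f x + (z - x) * m) with hφ
  have hφc : ContinuousOn φ (Set.Icc x y) := by
    refine (hf.mono fun z hz => hx0.trans hz.1).sub ?_
    fun_prop
  have hφx : φ x = 0 := by simp [hφ]
  have hφy : φ y = 0 := by simp only [hφ]; linarith
  suffices H : ∀ z ∈ Set.Icc x y, φ z ≤ 0 by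
    have hz : a • x + b • y ∈ Set.Icc x y := by
      have hb' : a = 1 - b := by linarith
      subst hb'
      simp only [smul_eq_mul, Set.mem_Icc]
      constructor <;> nlinarith
    have h := H _ hz
    have hb' : a = 1 - b := by linarith
    subst hb'
    simp only [hφ, smul_eq_mul] at h ⊢
    have e : ((1 - b) * x + b * y - x) * m = b * (m * (y - x)) := by ring
    rw [e, hm'] at h
    linarith
  obtain ⟨d, hd, hdmax⟩ :=
    isCompact_Icc.exists_isMaxOn (Set.nonempty_Icc.2 hxy.le) hφc
  by_contra! hcon
  obtain ⟨z, hz, hzpos⟩ := hcon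
  have hdpos : 0 < φ d := hzpos.trans_le (hdmax hz)
  have hK : IsCompact (Set.Icc x y ∩ φ ⁻¹' {φ d}) :=
    isCompact_Icc.of_isClosed_subset
      (hφc.preimage_isClosed_of_isClosed isClosed_Icc isClosed_singleton) Set.inter_subset_left
  obtain ⟨c, ⟨hc, hcd⟩, hcmin⟩ := hK.exists_isLeast ⟨d, hd, rfl⟩
  have hcd' : φ c = φ d := hcd
  have hxc : x < c := lt_of_le_of_ne hc.1 fun h => by rw [← h, hφx] at hcd'; linarith
  have hcy : c < y := lt_of_le_of_ne hc.2 fun h => by rw [h, hφy] at hcd'; linarith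
  set h := min (c - x) (y - c) with hh
  have hpos : 0 < h := lt_min (sub_pos.2 hxc) (sub_pos.2 hcy)
  have h1 : h ≤ c - x := min_le_left _ _
  have h2 : h ≤ y - c := min_le_right _ _
  have hl : c - h ∈ Set.Icc x y := ⟨by linarith, by linarith⟩
  have hr : c + h ∈ Set.Icc x y := ⟨by linarith, by linarith⟩
  have hlt : φ (c - h) < φ d := by
    refine lt_of_le_of_ne (hdmax hl) fun he => ?_
    have := hcmin ⟨hl, he⟩
    linarith
  have hle : φ (c + h) ≤ φ d := hdmax hr
  have := hmid (c - h) h (hx0.trans hl.1) hpos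
  rw [sub_add_cancel] at this
  simp only [hφ] at hlt hle hcd'
  nlinarith

/-- The probability mass of `n` under the Poisson distribution with rate `r`. -/
def poissonMass (r : ℝ) (n : ℕ) : ℝ := Real.exp (-r) * r ^ n / n.factorial

theorem poissonMass_nonneg {r : ℝ} (hr : 0 ≤ r) (n : ℕ) : 0 ≤ poissonMass r n := by
  unfold poissonMass; positivity

theorem hasSum_poissonMass {r : ℝ} (hr : 0 ≤ r) : HasSum (poissonMass r) 1 := by
  lift r to NNReal using hr
  exact hasSum_one_poissonMeasure r

theorem continuous_poissonMass (n : ℕ) : Continuous fun r => poissonMass r n := by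
  unfold poissonMass; fun_prop

theorem poissonMass_le {r R : ℝ} (hr : 0 ≤ r) (hR : r ≤ R) (n : ℕ) :
    poissonMass r n ≤ R ^ n / n.factorial := by
  unfold poissonMass
  gcongr
  calc Real.exp (-r) * r ^ n ≤ 1 * R ^ n := by
        gcongr
        exact Real.exp_le_one_iff.2 (by linarith)
    _ = R ^ n := one_mul _

theorem poissonMass_mul_poissonMass (r : ℝ) {s t : ℝ} (hst : s + t ≠ 0) (i j : ℕ) :
    poissonMass (r * s) i * poissonMass (r * t) j =
      ((i + j).choose i * ((s / (s + t)) ^ i * (t / (s + t)) ^ j)) *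
        poissonMass (r * (s + t)) (i + j) := by
  unfold poissonMass
  have h := Nat.add_choose_mul_factorial_mul_factorial i j
  rw [← Nat.choose_symm_add] at h
  have h' : ((i + j).choose i : ℝ) * i.factorial * j.factorial = (i + j).factorial := by
    exact_mod_cast h
  have hi : (i.factorial : ℝ) ≠ 0 := by positivity
  have hj : (j.factorial : ℝ) ≠ 0 := by positivity
  have hc : ((i + j).choose i : ℝ) ≠ 0 := by
    have := Nat.choose_pos (Nat.le_add_right i j)
    positivity
  rw [← h', show -(r * (s + t)) = -(r * s) + -(r * t) by ring, Real.exp_add]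
  simp only [mul_pow, div_pow, pow_add]
  field_simp

theorem sum_antidiagonal_binomial {s t : ℝ} (hst : s + t ≠ 0) (n : ℕ) :
    ∑ ij ∈ Finset.HasAntidiagonal.antidiagonal n,
      ((ij.1 + ij.2).choose ij.1 * ((s / (s + t)) ^ ij.1 * (t / (s + t)) ^ ij.2) : ℝ) = 1 := by
  have h := (Commute.all (s / (s + t)) (t / (s + t))).add_pow' n
  rw [← add_div, div_self hst, one_pow] at h
  rw [h]
  refine Finset.sum_congr rfl fun ij hij => ?_
  rw [Finset.HasAntidiagonal.mem_antidiagonal.1 hij, nsmul_eq_mul]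

/-- The unnormalized conditional entropy of a binary variable with weights `u` and `v`. -/
def pairEntropy (u v : ℝ) : ℝ := negMulLog u + negMulLog v - negMulLog (u + v)

theorem continuous_pairEntropy : Continuous fun z : ℝ × ℝ => pairEntropy z.1 z.2 := by
  unfold pairEntropy; fun_prop

theorem pairEntropy_eq (u v : ℝ) :
    pairEntropy u v = u * (log (u + v) - log u) + v * (log (u + v) - log v) := by
  unfold pairEntropy negMulLog; ring

theorem pairEntropy_mul (c u v : ℝ) : pairEntropy (c * u) (c * v) = c * pairEntropy u v := by
  unfold pairEntropy
  rw [← mul_add, negMulLog_mul, negMulLog_mul, negMulLog_mul]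
  ring

theorem mul_log_add_sub_log_nonneg {u v : ℝ} (hu : 0 ≤ u) (hv : 0 ≤ v) :
    0 ≤ u * (log (u + v) - log u) := by
  rcases hu.eq_or_lt with rfl | hu
  · simp
  · exact mul_nonneg hu.le (sub_nonneg.2 (log_le_log hu (by linarith)))

theorem mul_log_add_sub_log_le {u v : ℝ} (hu : 0 ≤ u) (hv : 0 ≤ v) :
    u * (log (u + v) - log u) ≤ v := by
  rcases hu.eq_or_lt with rfl | hu
  · simpa
  · rw [← log_div (by positivity) hu.ne']
    calc u * log ((u + v) / u) ≤ u * ((u + v) / u - 1) := by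
          gcongr
          exact log_le_sub_one_of_pos (by positivity)
      _ = v := by field_simp; ring

theorem pairEntropy_nonneg {u v : ℝ} (hu : 0 ≤ u) (hv : 0 ≤ v) : 0 ≤ pairEntropy u v := by
  have h := mul_log_add_sub_log_nonneg hv hu
  rw [add_comm v u] at h
  rw [pairEntropy_eq]
  exact add_nonneg (mul_log_add_sub_log_nonneg hu hv) h

theorem pairEntropy_le {u v : ℝ} (hu : 0 ≤ u) (hv : 0 ≤ v) : pairEntropy u v ≤ u + v := by
  have h := mul_log_add_sub_log_le hv hu
  rw [add_comm v u] at h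
  rw [pairEntropy_eq]
  linarith [mul_log_add_sub_log_le hu hv]

theorem summable_pairEntropy {ι : Type*} {f g : ι → ℝ} (hf : ∀ i, 0 ≤ f i) (hg : ∀ i, 0 ≤ g i)
    (hfs : Summable f) (hgs : Summable g) : Summable fun i => pairEntropy (f i) (g i) :=
  (hfs.add hgs).of_nonneg_of_le (fun i => pairEntropy_nonneg (hf i) (hg i))
    fun i => pairEntropy_le (hf i) (hg i)

theorem HasSum.mul_prod_of_nonneg {ι κ : Type*} {f : ι → ℝ} {g : κ → ℝ} {a b : ℝ}
    (hf : HasSum f a) (hg : HasSum g b) (hf0 : ∀ i, 0 ≤ f i) (hg0 : ∀ j, 0 ≤ g j) :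
    HasSum (fun z : ι × κ => f z.1 * g z.2) (a * b) :=
  hf.mul hg (hf.summable.mul_of_nonneg hg.summable hf0 hg0)

theorem mul_log_sub_eq {u a c T A C S U : ℝ} (hU : U = u * (a * c)) :
    U * (log S - log U) + U * (log T - log u) - U * (log A - log (u * a)) -
      U * (log C - log (u * c)) = U * (log S + log T - log A - log C) := by
  by_cases h : U = 0
  · simp [h]
  · subst hU
    simp only [mul_eq_zero, not_or] at h
    obtain ⟨hu, ha, hc⟩ := h
    rw [log_mul hu (mul_ne_zero ha hc), log_mul ha hc, log_mul hu ha, log_mul hu hc]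
    ring

theorem sub_le_mul_log {S T A C : ℝ} (hS : 0 ≤ S) (hT : 0 ≤ T) (hA : 0 ≤ A) (hC : 0 ≤ C)
    (h : S ≠ 0 → T ≠ 0 ∧ A ≠ 0 ∧ C ≠ 0) :
    S - A * C / T ≤ S * (log S + log T - log A - log C) := by
  by_cases hS0 : S = 0
  · subst hS0
    have : 0 ≤ A * C / T := by positivity
    linarith
  · obtain ⟨hT0, hA0, hC0⟩ := h hS0
    have hS' : 0 < S := lt_of_le_of_ne hS (Ne.symm hS0)
    have hA' : 0 < A := lt_of_le_of_ne hA (Ne.symm hA0)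
    have hC' : 0 < C := lt_of_le_of_ne hC (Ne.symm hC0)
    have hT' : 0 < T := lt_of_le_of_ne hT (Ne.symm hT0)
    have h1 := log_le_sub_one_of_pos (show 0 < A * C / (S * T) by positivity)
    rw [log_div (by positivity) (by positivity), log_mul hA0 hC0, log_mul hS0 hT0] at h1
    have h2 : S * (A * C / (S * T)) = A * C / T := by field_simp
    nlinarith

theorem sub_le_pairEntropy_mul {u v a b c d : ℝ} (hu : 0 ≤ u) (hv : 0 ≤ v) (ha : 0 ≤ a)
    (hb : 0 ≤ b) (hc : 0 ≤ c) (hd : 0 ≤ d) :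
    u * (a * c) + v * (b * d) - (u * a + v * b) * (u * c + v * d) / (u + v) ≤
      pairEntropy (u * (a * c)) (v * (b * d)) +
        (u * (log (u + v) - log u) * (a * c) + v * (log (u + v) - log v) * (b * d)) -
        (u * a * (log (u * a + v * b) - log (u * a)) * c +
          v * b * (log (u * a + v * b) - log (v * b)) * d) -
        (a * (u * c * (log (u * c + v * d) - log (u * c))) +
          b * (v * d * (log (u * c + v * d) - log (v * d)))) := by
  have key := sub_le_mul_log (S := u * (a * c) + v * (b * d)) (T := u + v)
    (A := u * a + v * b) (C := u * c + v * d)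
    (by positivity) (by positivity) (by positivity) (by positivity) (by
      intro h
      have hpos : ∀ {x y z w : ℝ}, 0 ≤ x → 0 ≤ y → 0 ≤ z → 0 ≤ w → x * (y * z) ≠ 0 →
          x + w ≠ 0 ∧ (∀ w, 0 ≤ w → x * y + w ≠ 0) ∧ ∀ w, 0 ≤ w → x * z + w ≠ 0 := by
        intro x y z w hx hy hz hw hne
        simp only [mul_ne_zero_iff] at hne
        obtain ⟨hx', hy', hz'⟩ := hne
        refine ⟨?_, fun w hw => ?_, fun w hw => ?_⟩ <;> positivity
      rcases eq_or_ne (u * (a * c)) 0 with h0 | h0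
      · rw [h0, zero_add] at h
        obtain ⟨h1, h2, h3⟩ := hpos hv hb hd hu h
        rw [add_comm u, add_comm (u * a), add_comm (u * c)]
        exact ⟨h1, h2 _ (by positivity), h3 _ (by positivity)⟩
      · obtain ⟨h1, h2, h3⟩ := hpos hu ha hc hv h0
        exact ⟨h1, h2 _ (by positivity), h3 _ (by positivity)⟩)
  have e1 := mul_log_sub_eq (T := u + v) (A := u * a + v * b) (C := u * c + v * d)
    (S := u * (a * c) + v * (b * d)) (rfl : u * (a * c) = u * (a * c))
  have e2 := mul_log_sub_eq (T := u + v) (A := u * a + v * b) (C := u * c + v * d)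
    (S := u * (a * c) + v * (b * d)) (rfl : v * (b * d) = v * (b * d))
  rw [pairEntropy_eq]
  linarith

theorem two_mul_tsum_pairEntropy_le {P Q : ℕ → ℝ} (hP : HasSum P 1) (hQ : HasSum Q 1)
    (hP0 : ∀ n, 0 ≤ P n) (hQ0 : ∀ n, 0 ≤ Q n) {u v : ℝ} (hu : 0 ≤ u) (hv : 0 ≤ v) :
    2 * ∑' n, pairEntropy (u * P n) (v * Q n) ≤ pairEntropy u v +
      ∑' z : ℕ × ℕ, pairEntropy (u * (P z.1 * P z.2)) (v * (Q z.1 * Q z.2)) := by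
  have huP : ∀ n, 0 ≤ u * P n := fun n => mul_nonneg hu (hP0 n)
  have hvQ : ∀ n, 0 ≤ v * Q n := fun n => mul_nonneg hv (hQ0 n)
  have hPP := hP.mul_prod_of_nonneg hP hP0 hP0
  have hQQ := hQ.mul_prod_of_nonneg hQ hQ0 hQ0
  rw [one_mul] at hPP hQQ
  have hf0 : ∀ n, 0 ≤ u * P n * (log (u * P n + v * Q n) - log (u * P n)) := fun n =>
    mul_log_add_sub_log_nonneg (huP n) (hvQ n)
  have hg0 : ∀ n, 0 ≤ v * Q n * (log (u * P n + v * Q n) - log (v * Q n)) := fun n => by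
    rw [add_comm (u * P n)]
    exact mul_log_add_sub_log_nonneg (hvQ n) (huP n)
  have hf : Summable fun n => u * P n * (log (u * P n + v * Q n) - log (u * P n)) :=
    (hQ.summable.mul_left v).of_nonneg_of_le hf0 fun n => mul_log_add_sub_log_le (huP n) (hvQ n)
  have hg : Summable fun n => v * Q n * (log (u * P n + v * Q n) - log (v * Q n)) :=
    (hP.summable.mul_left u).of_nonneg_of_le hg0 fun n => by
      rw [add_comm (u * P n)]
      exact mul_log_add_sub_log_le (hvQ n) (huP n)
  have hfg : ∑' n, pairEntropy (u * P n) (v * Q n) =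
      ∑' n, u * P n * (log (u * P n + v * Q n) - log (u * P n)) +
        ∑' n, v * Q n * (log (u * P n + v * Q n) - log (v * Q n)) := by
    rw [← hf.tsum_add hg]
    exact tsum_congr fun n => pairEntropy_eq _ _
  have hG : Summable fun z : ℕ × ℕ =>
      pairEntropy (u * (P z.1 * P z.2)) (v * (Q z.1 * Q z.2)) :=
    summable_pairEntropy (fun z => mul_nonneg hu (mul_nonneg (hP0 _) (hP0 _)))
      (fun z => mul_nonneg hv (mul_nonneg (hQ0 _) (hQ0 _)))
      (hPP.summable.mul_left u) (hQQ.summable.mul_left v)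
  have hS := (hP.mul_left u).add (hQ.mul_left v)
  have hS0 : ∀ n, 0 ≤ u * P n + v * Q n := fun n => add_nonneg (huP n) (hvQ n)
  have hlhs := ((hPP.mul_left u).add (hQQ.mul_left v)).sub
    ((hS.mul_prod_of_nonneg hS hS0 hS0).div_const (u + v))
  have hrhs := ((hG.hasSum.add ((hPP.mul_left (u * (log (u + v) - log u))).add
    (hQQ.mul_left (v * (log (u + v) - log v))))).sub
    ((hf.hasSum.mul_prod_of_nonneg hP hf0 hP0).add
      (hg.hasSum.mul_prod_of_nonneg hQ hg0 hQ0))).sub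
    ((hP.mul_prod_of_nonneg hf.hasSum hP0 hf0).add
      (hQ.mul_prod_of_nonneg hg.hasSum hQ0 hg0))
  have h := hasSum_le (fun z : ℕ × ℕ => sub_le_pairEntropy_mul hu hv (hP0 z.1) (hQ0 z.1)
    (hP0 z.2) (hQ0 z.2)) hlhs hrhs
  have hzero : (u * 1 + v * 1) * (u * 1 + v * 1) / (u + v) = u + v := by
    rw [mul_one, mul_one, mul_self_div_self]
  rw [hzero] at h
  rw [hfg, pairEntropy_eq u v]
  linarith

/-- The entropy of a binary input with weights `u` and `v` given the output at time `t` of a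
Poisson channel with rates `r` and `s`. -/
def condEntropy (r s u v t : ℝ) : ℝ :=
  ∑' n, pairEntropy (u * poissonMass (r * t) n) (v * poissonMass (s * t) n)

section condEntropy

variable {r s u v : ℝ}

theorem continuousOn_condEntropy (hr : 0 ≤ r) (hs : 0 ≤ s) (hu : 0 ≤ u) (hv : 0 ≤ v) :
    ContinuousOn (condEntropy r s u v) (Set.Ici 0) := by
  have hterm : ∀ n, Continuous fun t =>
      pairEntropy (u * poissonMass (r * t) n) (v * poissonMass (s * t) n) := fun n => by
    have h1 := (continuous_poissonMass n).comp (continuous_const_mul r)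
    have h2 := (continuous_poissonMass n).comp (continuous_const_mul s)
    exact continuous_pairEntropy.comp ((h1.const_mul u).prodMk (h2.const_mul v))
  have hIcc : ∀ R, 0 ≤ R → ContinuousOn (condEntropy r s u v) (Set.Icc 0 R) := fun R hR => by
    refine continuousOn_tsum (u := fun n : ℕ => u * ((r * R) ^ n / n.factorial) +
      v * ((s * R) ^ n / n.factorial)) (fun n => (hterm n).continuousOn) ?_ ?_
    · exact ((Real.summable_pow_div_factorial _).mul_left u).add
        ((Real.summable_pow_div_factorial _).mul_left v)
    · intro n t ht
      have h1 := poissonMass_nonneg (mul_nonneg hr ht.1) n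
      have h2 := poissonMass_nonneg (mul_nonneg hs ht.1) n
      have h3 := poissonMass_le (mul_nonneg hr ht.1) (mul_le_mul_of_nonneg_left ht.2 hr) n
      have h4 := poissonMass_le (mul_nonneg hs ht.1) (mul_le_mul_of_nonneg_left ht.2 hs) n
      rw [Real.norm_of_nonneg (pairEntropy_nonneg (by positivity) (by positivity))]
      refine (pairEntropy_le (by positivity) (by positivity)).trans ?_
      gcongr
  intro t ht
  have ht' : (0 : ℝ) ≤ t := ht
  refine ((hIcc (t + 1) (by linarith)) t ⟨ht, by linarith⟩).mono_of_mem_nhdsWithin ?_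
  rw [← Set.Ici_inter_Iic]
  exact Filter.inter_mem self_mem_nhdsWithin
    (mem_nhdsWithin_of_mem_nhds (Iic_mem_nhds (by linarith)))

theorem hasSum_condEntropy_add (hr : 0 ≤ r) (hs : 0 ≤ s) (hu : 0 ≤ u) (hv : 0 ≤ v) {a b : ℝ}
    (ha : 0 ≤ a) (hb : 0 ≤ b) (hab : a + b ≠ 0) :
    HasSum (fun z : ℕ × ℕ =>
      pairEntropy (u * (poissonMass (r * a) z.1 * poissonMass (r * b) z.2))
        (v * (poissonMass (s * a) z.1 * poissonMass (s * b) z.2)))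
      (condEntropy r s u v (a + b)) := by
  have hmass : ∀ {x : ℝ}, 0 ≤ x → HasSum
      (fun z : ℕ × ℕ => poissonMass (x * a) z.1 * poissonMass (x * b) z.2) (1 * 1) := fun hx =>
    (hasSum_poissonMass (mul_nonneg hx ha)).mul_prod_of_nonneg
      (hasSum_poissonMass (mul_nonneg hx hb)) (poissonMass_nonneg (mul_nonneg hx ha))
      (poissonMass_nonneg (mul_nonneg hx hb))
  have hmass0 : ∀ {x : ℝ}, 0 ≤ x → ∀ z : ℕ × ℕ,
      0 ≤ poissonMass (x * a) z.1 * poissonMass (x * b) z.2 := fun hx z =>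
    mul_nonneg (poissonMass_nonneg (mul_nonneg hx ha) _) (poissonMass_nonneg (mul_nonneg hx hb) _)
  have hsum := summable_pairEntropy (fun z => mul_nonneg hu (hmass0 hr z))
    (fun z => mul_nonneg hv (hmass0 hs z)) ((hmass hr).summable.mul_left u)
    ((hmass hs).summable.mul_left v)
  convert hsum.hasSum using 1
  rw [← Finset.HasAntidiagonal.sigmaAntidiagonalEquivProd.tsum_eq]
  refine Eq.trans ?_ (Summable.tsum_sigma
    (Finset.HasAntidiagonal.sigmaAntidiagonalEquivProd.summable_iff.2 hsum)).symm
  refine tsum_congr fun n => ?_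
  rw [tsum_fintype]
  have hterm : ∀ ij ∈ Finset.HasAntidiagonal.antidiagonal n,
      pairEntropy (u * (poissonMass (r * a) ij.1 * poissonMass (r * b) ij.2))
        (v * (poissonMass (s * a) ij.1 * poissonMass (s * b) ij.2)) =
      ((ij.1 + ij.2).choose ij.1 * ((a / (a + b)) ^ ij.1 * (b / (a + b)) ^ ij.2)) *
        pairEntropy (u * poissonMass (r * (a + b)) n) (v * poissonMass (s * (a + b)) n) := by
    intro ij hij
    rw [poissonMass_mul_poissonMass r hab, poissonMass_mul_poissonMass s hab,
      Finset.HasAntidiagonal.mem_antidiagonal.1 hij, mul_left_comm u, mul_left_comm v,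
      pairEntropy_mul]
  have hmain := Finset.sum_congr rfl hterm
  rw [← Finset.sum_mul, sum_antidiagonal_binomial hab, one_mul] at hmain
  rw [← hmain, ← Finset.sum_attach]
  rfl

theorem two_mul_condEntropy_le (hr : 0 ≤ r) (hs : 0 ≤ s) (hu : 0 ≤ u) (hv : 0 ≤ v) {h : ℝ}
    (hh : 0 < h) :
    2 * condEntropy r s u v h ≤ pairEntropy u v + condEntropy r s u v (h + h) := by
  have hr' := mul_nonneg hr hh.le
  have hs' := mul_nonneg hs hh.le
  rw [← (hasSum_condEntropy_add hr hs hu hv hh.le hh.le (by positivity)).tsum_eq]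
  exact two_mul_tsum_pairEntropy_le (hasSum_poissonMass hr') (hasSum_poissonMass hs')
    (poissonMass_nonneg hr') (poissonMass_nonneg hs') hu hv

theorem hasSum_condEntropy (hr : 0 ≤ r) (hs : 0 ≤ s) (hu : 0 ≤ u) (hv : 0 ≤ v) {t : ℝ}
    (ht : 0 ≤ t) :
    HasSum (fun n => pairEntropy (u * poissonMass (r * t) n) (v * poissonMass (s * t) n))
      (condEntropy r s u v t) := by
  have hr' := mul_nonneg hr ht
  have hs' := mul_nonneg hs ht
  exact (summable_pairEntropy (fun n => mul_nonneg hu (poissonMass_nonneg hr' n))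
    (fun n => mul_nonneg hv (poissonMass_nonneg hs' n))
    ((hasSum_poissonMass hr').summable.mul_left u)
    ((hasSum_poissonMass hs').summable.mul_left v)).hasSum

theorem hasSum_condEntropy_comp (hr : 0 ≤ r) (hs : 0 ≤ s) (hu : 0 ≤ u) (hv : 0 ≤ v) {a b : ℝ}
    (ha : 0 ≤ a) (hb : 0 < b) :
    HasSum (fun n =>
      condEntropy r s (u * poissonMass (r * a) n) (v * poissonMass (s * a) n) b)
      (condEntropy r s u v (a + b)) := by
  have h := hasSum_condEntropy_add hr hs hu hv ha hb.le (by positivity)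
  simp only [← mul_assoc] at h
  refine h.prod_fiberwise fun n => ?_
  exact hasSum_condEntropy hr hs (mul_nonneg hu (poissonMass_nonneg (mul_nonneg hr ha) n))
    (mul_nonneg hv (poissonMass_nonneg (mul_nonneg hs ha) n)) hb.le

theorem convexOn_condEntropy (hr : 0 ≤ r) (hs : 0 ≤ s) (hu : 0 ≤ u) (hv : 0 ≤ v) :
    ConvexOn ℝ (Set.Ici 0) (condEntropy r s u v) := by
  refine convexOn_Ici_of_continuousOn_of_midpoint (continuousOn_condEntropy hr hs hu hv) ?_
  intro a h ha hh
  have h1 := (hasSum_condEntropy_comp hr hs hu hv ha hh).mul_left 2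
  have h2 := (hasSum_condEntropy hr hs hu hv ha).add
    (hasSum_condEntropy_comp hr hs hu hv ha (add_pos hh hh))
  rw [← add_assoc] at h2
  exact hasSum_le (fun n => two_mul_condEntropy_le hr hs
    (mul_nonneg hu (poissonMass_nonneg (mul_nonneg hr ha) n))
    (mul_nonneg hv (poissonMass_nonneg (mul_nonneg hs ha) n)) hh) h1 h2

end condEntropy

theorem negMulLog_le_inv_add_mul {x c : ℝ} (hx : 0 ≤ x) (hc : 0 < c) :
    negMulLog x ≤ c⁻¹ + c * x := by
  rcases hx.eq_or_lt with rfl | hx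
  · simp [hc.le]
  · have h1 := log_le_sub_one_of_pos (show 0 < (c * x)⁻¹ by positivity)
    have h2 := log_le_sub_one_of_pos hc
    rw [log_inv, log_mul hc.ne' hx.ne'] at h1
    have h3 : x * (c * x)⁻¹ = c⁻¹ := by field_simp
    unfold negMulLog
    nlinarith

theorem summable_negMulLog_poissonMass {r : ℝ} (hr : 0 ≤ r) :
    Summable fun n => negMulLog (poissonMass r n) := by
  have hle : ∀ n, poissonMass r n ≤ 1 := fun n =>
    le_hasSum (hasSum_poissonMass hr) n fun m _ => poissonMass_nonneg hr m
  have hbound : ∀ n, negMulLog (poissonMass r n) ≤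
      (1 / 2) ^ n + Real.exp (-r) * ((2 * r) ^ n / n.factorial) := fun n => by
    have h := negMulLog_le_inv_add_mul (c := 2 ^ n) (poissonMass_nonneg hr n) (by positivity)
    have e : (2 : ℝ) ^ n * poissonMass r n = Real.exp (-r) * ((2 * r) ^ n / n.factorial) := by
      rw [poissonMass, mul_pow]
      ring
    rwa [e, ← inv_pow, ← one_div] at h
  exact Summable.of_nonneg_of_le
    (fun n => negMulLog_nonneg (poissonMass_nonneg hr n) (hle n)) hbound
    (summable_geometric_two.add ((Real.summable_pow_div_factorial _).mul_left _))

theorem summable_negMulLog_mul_poissonMass (w : ℝ) {r : ℝ} (hr : 0 ≤ r) :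
    Summable fun n => negMulLog (w * poissonMass r n) := by
  simp only [negMulLog_mul]
  exact ((hasSum_poissonMass hr).summable.mul_right _).add
    ((summable_negMulLog_poissonMass hr).mul_left _)

theorem hasSum_negMulLog_pi {ι : Type*} {f : ι → ℝ} (hf0 : ∀ i, 0 ≤ f i) (hf : HasSum f 1)
    {h : ℝ} (hh : HasSum (fun i => negMulLog (f i)) h) (n : ℕ) :
    HasSum (fun z : Fin n → ι => ∏ i, f (z i)) 1 ∧
      HasSum (fun z : Fin n → ι => negMulLog (∏ i, f (z i))) (n * h) := by
  have hent : ∀ i, 0 ≤ negMulLog (f i) := fun i =>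
    negMulLog_nonneg (hf0 i) (le_hasSum hf i fun j _ => hf0 j)
  induction n with
  | zero =>
    constructor
    · convert hasSum_unique (fun z : Fin 0 → ι => ∏ i, f (z i)) using 1
      simp
    · convert hasSum_unique (fun z : Fin 0 → ι => negMulLog (∏ i, f (z i))) using 1
      simp
  | succ n ih =>
    obtain ⟨ih1, ih2⟩ := ih
    have hg0 : ∀ z : Fin n → ι, 0 ≤ ∏ i, f (z i) := fun z => Finset.prod_nonneg fun i _ => hf0 _
    have hge : ∀ z : Fin n → ι, 0 ≤ negMulLog (∏ i, f (z i)) := fun z =>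
      negMulLog_nonneg (hg0 z) (le_hasSum ih1 z fun j _ => hg0 j)
    rw [← (Fin.consEquiv fun _ => ι).hasSum_iff, ← (Fin.consEquiv fun _ => ι).hasSum_iff]
    constructor
    · have := hf.mul_prod_of_nonneg ih1 hf0 hg0
      rw [one_mul] at this
      refine this.congr_fun fun z => ?_
      simp [Fin.consEquiv, Fin.prod_univ_succ]
    · have h1 := hh.mul_prod_of_nonneg ih1 hent hg0
      have h2 := hf.mul_prod_of_nonneg ih2 hf0 hge
      have h3 := h1.add h2
      rw [show h * 1 + 1 * (n * h) = (n + 1 : ℕ) * h by push_cast; ring] at h3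
      refine h3.congr_fun fun z => ?_
      simp [Fin.consEquiv, Fin.prod_univ_succ, negMulLog_mul, mul_comm]

theorem hasSum_prod_of_support_pair {α β : Type*} {g : α × β → ℝ} {x y : α} (hxy : x ≠ y)
    (h0 : ∀ z : α × β, z.1 ≠ x → z.1 ≠ y → g z = 0) {a b : ℝ}
    (hx : HasSum (fun n => g (x, n)) a) (hy : HasSum (fun n => g (y, n)) b) :
    HasSum g (a + b) := by
  classical
  have hfiber : ∀ {w : α} {c : ℝ}, HasSum (fun n => g (w, n)) c →
      HasSum (fun z : α × β => if z.1 = w then g z else 0) c := by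
    intro w c hw
    have hinj : Function.Injective fun n : β => (w, n) := fun m n h => (Prod.ext_iff.1 h).2
    rw [← hinj.hasSum_iff]
    · simpa [Function.comp_def] using hw
    · rintro ⟨w', n⟩ hz
      refine if_neg fun h => hz ⟨n, ?_⟩
      exact Prod.ext h.symm rfl
  refine ((hfiber hx).add (hfiber hy)).congr_fun fun z => ?_
  by_cases h1 : z.1 = x
  · simp [h1, hxy]
  · by_cases h2 : z.1 = y
    · simp [h2, hxy.symm]
    · simp [h1, h2, h0 z h1 h2]

theorem measureEntropy_eq_tsum {S : Type*} [MeasurableSpace S] (μ : Measure S)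
    [IsProbabilityMeasure μ] : measureEntropy μ = ∑' s, negMulLog (μ {s}).toReal := by
  simp [measureEntropy]

instance isProbabilityMeasure_poissonMeasure (r : ℝ) :
    IsProbabilityMeasure (_root_.poissonMeasure r) := by
  unfold _root_.poissonMeasure
  infer_instance

theorem poissonMeasure_singleton_eq (r : ℝ) (n : ℕ) :
    _root_.poissonMeasure r {n} = ENNReal.ofReal (poissonMass (max r 0) n) := by
  unfold _root_.poissonMeasure
  rw [PMF.toMeasure_apply_singleton _ _ (measurableSet_singleton n)]
  rfl

theorem measurable_poissonMeasure_singleton (c : ℝ) (n : ℕ) :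
    Measurable fun x : ℝ => _root_.poissonMeasure (c * x) {n} := by
  simp only [poissonMeasure_singleton_eq]
  exact ((continuous_poissonMass n).measurable.comp
    ((measurable_id.const_mul c).max measurable_const)).ennreal_ofReal

section inputLaw

variable {p a b : ℝ}

theorem isProbabilityMeasure_inputLaw (hp0 : 0 ≤ p) (hp1 : p ≤ 1) :
    IsProbabilityMeasure (inputLaw p a b) := by
  constructor
  simp only [inputLaw, Measure.add_apply, Measure.smul_apply, measure_univ, smul_eq_mul, mul_one]
  rw [← ENNReal.ofReal_add hp0 (by linarith)]
  simp

theorem inputLaw_singleton_right (hab : a < b) : inputLaw p a b {b} = ENNReal.ofReal p := by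
  simp [inputLaw, hab.ne]

theorem inputLaw_singleton_left (hab : a < b) :
    inputLaw p a b {a} = ENNReal.ofReal (1 - p) := by
  simp [inputLaw, hab.ne']

theorem inputLaw_singleton_of_ne {x : ℝ} (ha : x ≠ a) (hb : x ≠ b) : inputLaw p a b {x} = 0 := by
  simp [inputLaw, ha.symm, hb.symm]

theorem lintegral_inputLaw (f : ℝ → ENNReal) :
    ∫⁻ x, f x ∂inputLaw p a b = ENNReal.ofReal p * f b + ENNReal.ofReal (1 - p) * f a := by
  rw [inputLaw, lintegral_add_measure, lintegral_smul_measure, lintegral_smul_measure,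
    lintegral_dirac, lintegral_dirac, smul_eq_mul, smul_eq_mul]

theorem ae_inputLaw_mem : ∀ᵐ x ∂inputLaw p a b, x ∈ ({a, b} : Set ℝ) := by
  rw [inputLaw, ae_add_measure_iff]
  constructor <;> refine Measure.ae_smul_measure ?_ _ <;> simp [ae_dirac_eq]

theorem aemeasurable_XLaw {β : Type*} [MeasurableSpace β] (hp0 : 0 ≤ p) (hp1 : p ≤ 1)
    (f : (Fin 4 → ℝ) → β) : AEMeasurable f (XLaw p a b) := by
  have := isProbabilityMeasure_inputLaw (a := a) (b := b) hp0 hp1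
  set s : Set (Fin 4 → ℝ) := Set.univ.pi fun _ => {a, b} with hs
  have hfin : s.Finite := Set.Finite.pi fun _ => by simp
  have hmem : ∀ᵐ x ∂XLaw p a b, x ∈ s := by
    have : ∀ᵐ x ∂XLaw p a b, ∀ i, x i ∈ ({a, b} : Set ℝ) :=
      ae_all_iff.2 fun i => Measure.tendsto_eval_ae_ae.eventually ae_inputLaw_mem
    filter_upwards [this] with x hx i _ using hx i
  rw [← Measure.restrict_eq_self_of_ae_mem hmem, ← Set.biUnion_of_singleton s,
    Set.biUnion_eq_iUnion]
  have := hfin.countable.to_subtype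
  refine aemeasurable_iUnion_iff.2 fun i => ?_
  rw [Measure.restrict_singleton]
  exact aemeasurable_dirac.smul_measure _

end inputLaw

/-- Joint law of `X` and four outputs, the `i`-th of which observes `X i` alone for time `c`. -/
def singletsLaw (p a b c : ℝ) : Measure ((Fin 4 → ℝ) × (Fin 4 → ℕ)) :=
  (XLaw p a b).bind fun x =>
    (Measure.pi fun i => _root_.poissonMeasure (c * x i)).map fun y => (x, y)

theorem poissonJointLaw_singlets (p a b T : ℝ) (idx : Fin 4 → Fin 15)
    (hidx : ∀ i, (idx i).val = i.val) :
    poissonJointLaw p a b (fun i => if i.val ≤ 3 then T / 4 else 0) idx =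
      singletsLaw p a b (T / 4) := by
  obtain rfl : idx = Fin.castLE (by norm_num) := funext fun i => Fin.ext (hidx i)
  have h : ∀ (x : Fin 4 → ℝ) (i : Fin 4),
      (if (Fin.castLE (by norm_num : 4 ≤ 15) i).val ≤ 3 then T / 4 else 0) *
        ∑ j ∈ sens (Fin.castLE (by norm_num) i), x j = T / 4 * x i := by
    intro x i
    fin_cases i <;> simp [sens]
  unfold poissonJointLaw singletsLaw
  simp only [h]

section singletsLaw

variable {p a b c : ℝ}

theorem singletsLaw_apply (hp0 : 0 ≤ p) (hp1 : p ≤ 1) {s : Set ((Fin 4 → ℝ) × (Fin 4 → ℕ))}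
    (hs : MeasurableSet s) :
    singletsLaw p a b c s = ∫⁻ x, Measure.pi (fun i => _root_.poissonMeasure (c * x i))
      (Prod.mk x ⁻¹' s) ∂XLaw p a b := by
  rw [singletsLaw, Measure.bind_apply hs (aemeasurable_XLaw hp0 hp1 _)]
  refine lintegral_congr fun x => ?_
  rw [Measure.map_apply measurable_prodMk_left hs]

theorem map_fst_singletsLaw (hp0 : 0 ≤ p) (hp1 : p ≤ 1) :
    (singletsLaw p a b c).map Prod.fst = XLaw p a b := by
  ext s hs
  rw [Measure.map_apply measurable_fst hs, singletsLaw_apply hp0 hp1 (measurable_fst hs),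
    ← lintegral_indicator_one hs]
  refine lintegral_congr fun x => ?_
  by_cases hx : x ∈ s
  · have : Prod.mk x ⁻¹' (Prod.fst ⁻¹' s) = (Set.univ : Set (Fin 4 → ℕ)) := by ext; simp [hx]
    rw [this, measure_univ, Set.indicator_of_mem hx, Pi.one_apply]
  · have : Prod.mk x ⁻¹' (Prod.fst ⁻¹' s) = (∅ : Set (Fin 4 → ℕ)) := by ext; simp [hx]
    rw [this, measure_empty, Set.indicator_of_notMem hx]

theorem isProbabilityMeasure_singletsLaw (hp0 : 0 ≤ p) (hp1 : p ≤ 1) :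
    IsProbabilityMeasure (singletsLaw p a b c) := by
  have := isProbabilityMeasure_inputLaw (a := a) (b := b) hp0 hp1
  constructor
  rw [← Set.preimage_univ (f := Prod.fst), ← Measure.map_apply measurable_fst MeasurableSet.univ,
    map_fst_singletsLaw hp0 hp1, XLaw, measure_univ]

theorem singletsLaw_singleton (hp0 : 0 ≤ p) (hp1 : p ≤ 1) (x : Fin 4 → ℝ) (y : Fin 4 → ℕ) :
    singletsLaw p a b c {(x, y)} =
      ∏ i, inputLaw p a b {x i} * _root_.poissonMeasure (c * x i) {y i} := by
  have := isProbabilityMeasure_inputLaw (a := a) (b := b) hp0 hp1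
  rw [singletsLaw_apply hp0 hp1 (measurableSet_singleton _), Finset.prod_mul_distrib,
    ← Measure.pi_singleton (fun i => _root_.poissonMeasure (c * x i)) y,
    ← Measure.pi_singleton (fun _ => inputLaw p a b) x, mul_comm,
    ← lintegral_indicator_const (measurableSet_singleton x)]
  refine lintegral_congr fun x' => ?_
  by_cases hx : x' = x
  · subst hx
    rw [Set.indicator_of_mem (Set.mem_singleton _)]
    congr 1
    ext; simp
  · rw [Set.indicator_of_notMem (show x' ∉ ({x} : Set (Fin 4 → ℝ)) from hx)]
    have : Prod.mk x' ⁻¹' {(x, y)} = (∅ : Set (Fin 4 → ℕ)) := by ext; simp [hx]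
    rw [this, measure_empty]

theorem map_snd_singletsLaw_singleton (hp0 : 0 ≤ p) (hp1 : p ≤ 1) (y : Fin 4 → ℕ) :
    (singletsLaw p a b c).map Prod.snd {y} =
      ∏ i, (ENNReal.ofReal p * _root_.poissonMeasure (c * b) {y i} +
        ENNReal.ofReal (1 - p) * _root_.poissonMeasure (c * a) {y i}) := by
  have := isProbabilityMeasure_inputLaw (a := a) (b := b) hp0 hp1
  have hy := measurableSet_singleton y
  rw [Measure.map_apply measurable_snd hy, singletsLaw_apply hp0 hp1 (measurable_snd hy)]
  have h : ∀ x : Fin 4 → ℝ, Measure.pi (fun i => _root_.poissonMeasure (c * x i))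
      (Prod.mk x ⁻¹' (Prod.snd ⁻¹' {y})) = ∏ i, _root_.poissonMeasure (c * x i) {y i} := fun x =>
    Measure.pi_singleton (fun i => _root_.poissonMeasure (c * x i)) y
  have hmeas := fun i : Fin 4 => measurable_poissonMeasure_singleton c (y i)
  simp only [h]
  rw [XLaw, lintegral_prod_eq_prod_lintegral_of_indepFun Finset.univ
    (fun i (x : Fin 4 → ℝ) => _root_.poissonMeasure (c * x i) {y i})
    (iIndepFun_pi fun i => (hmeas i).aemeasurable)
    fun i => (hmeas i).comp (measurable_pi_apply i)]
  refine Finset.prod_congr rfl fun i _ => ?_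
  rw [← lintegral_inputLaw fun x => _root_.poissonMeasure (c * x) {y i}]
  exact (measurePreserving_eval (fun _ : Fin 4 => inputLaw p a b) i).lintegral_comp (hmeas i)

theorem measureMutualInfo_singletsLaw (hp0 : 0 < p) (hp1 : p < 1) (ha : 0 ≤ a) (hab : a < b)
    (hc : 0 ≤ c) :
    measureMutualInfo (singletsLaw p a b c) =
      measureEntropy (XLaw p a b) - 4 * condEntropy b a p (1 - p) c := by
  have hb : 0 ≤ b := ha.trans hab.le
  have hq0 : 0 ≤ 1 - p := by linarith
  have hbc : 0 ≤ b * c := mul_nonneg hb hc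
  have hac : 0 ≤ a * c := mul_nonneg ha hc
  have := isProbabilityMeasure_singletsLaw (a := a) (b := b) (c := c) hp0.le hp1.le
  have : IsProbabilityMeasure ((singletsLaw p a b c).map Prod.snd) :=
    Measure.isProbabilityMeasure_map measurable_snd.aemeasurable
  have hu0 : ∀ n, 0 ≤ p * poissonMass (b * c) n := fun n =>
    mul_nonneg hp0.le (poissonMass_nonneg hbc n)
  have hv0 : ∀ n, 0 ≤ (1 - p) * poissonMass (a * c) n := fun n =>
    mul_nonneg hq0 (poissonMass_nonneg hac n)
  have hu := (hasSum_poissonMass hbc).mul_left p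
  have hv := (hasSum_poissonMass hac).mul_left (1 - p)
  obtain ⟨A, hue⟩ := summable_negMulLog_mul_poissonMass p hbc
  obtain ⟨B, hve⟩ := summable_negMulLog_mul_poissonMass (1 - p) hac
  -- the law of a single output
  set S : ℕ → ℝ := fun n => p * poissonMass (b * c) n + (1 - p) * poissonMass (a * c) n with hS
  have hS0 : ∀ n, 0 ≤ S n := fun n => add_nonneg (hu0 n) (hv0 n)
  have hone : p * 1 + (1 - p) * 1 = 1 := by ring
  have hS1 : HasSum S 1 := hone ▸ hu.add hv
  have hSe : HasSum (fun n => negMulLog (S n)) (A + B - condEntropy b a p (1 - p) c) :=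
    ((hue.add hve).sub (hasSum_condEntropy hb ha hp0.le hq0 hc)).congr_fun fun n => by
      simp only [pairEntropy, hS]; ring
  have hsnd : measureEntropy ((singletsLaw p a b c).map Prod.snd) =
      (4 : ℕ) * (A + B - condEntropy b a p (1 - p) c) := by
    rw [measureEntropy_eq_tsum, ← (hasSum_negMulLog_pi hS0 hS1 hSe 4).2.tsum_eq]
    refine tsum_congr fun y => ?_
    rw [map_snd_singletsLaw_singleton hp0.le hp1.le, ENNReal.toReal_prod]
    congr 1
    refine Finset.prod_congr rfl fun i _ => ?_
    rw [mul_comm c, mul_comm c, poissonMeasure_singleton_eq, poissonMeasure_singleton_eq,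
      max_eq_left hbc, max_eq_left hac, ← ENNReal.ofReal_mul hp0.le, ← ENNReal.ofReal_mul hq0,
      ← ENNReal.ofReal_add (hu0 _) (hv0 _), ENNReal.toReal_ofReal (hS0 _)]
  -- the joint law of a single input and its output
  set q : ℝ × ℕ → ℝ := fun z =>
    (inputLaw p a b {z.1} * _root_.poissonMeasure (c * z.1) {z.2}).toReal with hq
  have hqb : ∀ n, q (b, n) = p * poissonMass (b * c) n := fun n => by
    simp only [hq]
    rw [inputLaw_singleton_right hab, mul_comm c, poissonMeasure_singleton_eq, max_eq_left hbc,
      ← ENNReal.ofReal_mul hp0.le, ENNReal.toReal_ofReal (hu0 _)]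
  have hqa : ∀ n, q (a, n) = (1 - p) * poissonMass (a * c) n := fun n => by
    simp only [hq]
    rw [inputLaw_singleton_left hab, mul_comm c, poissonMeasure_singleton_eq, max_eq_left hac,
      ← ENNReal.ofReal_mul hq0, ENNReal.toReal_ofReal (hv0 _)]
  have hqz : ∀ z : ℝ × ℕ, z.1 ≠ b → z.1 ≠ a → q z = 0 := fun z h1 h2 => by
    simp only [hq]
    rw [inputLaw_singleton_of_ne h2 h1, zero_mul, ENNReal.toReal_zero]
  have hq1 : HasSum q 1 :=
    hone ▸ hasSum_prod_of_support_pair hab.ne' hqz (by simpa only [hqb] using hu)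
      (by simpa only [hqa] using hv)
  have hqe := hasSum_prod_of_support_pair (g := fun z => negMulLog (q z)) hab.ne'
    (fun z h1 h2 => by simp only [hqz z h1 h2, negMulLog_zero])
    (by simpa only [hqb] using hue) (by simpa only [hqa] using hve)
  have hjoint : measureEntropy (singletsLaw p a b c) = (4 : ℕ) * (A + B) := by
    rw [measureEntropy_eq_tsum,
      ← (hasSum_negMulLog_pi (fun z => ENNReal.toReal_nonneg) hq1 hqe 4).2.tsum_eq,
      ← (Equiv.arrowProdEquivProdArrow (Fin 4) (fun _ => ℝ) fun _ => ℕ).tsum_eq]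
    refine tsum_congr fun z => ?_
    rw [← ENNReal.toReal_prod]
    exact congrArg (fun w : ENNReal => negMulLog w.toReal)
      (singletsLaw_singleton hp0.le hp1.le _ _)
  rw [measureMutualInfo, map_fst_singletsLaw hp0.le hp1.le, hsnd, hjoint]
  push_cast
  ring

end singletsLaw

/-- `T ↦ I(X₁,…,X₄; Y₁,…,Y₄)` with `T₁ = ⋯ = T₄ = T/4` and all other
times `0` is concave on `[0,∞)`. -/
theorem poisson_mutualInfo_singlets_concave
    (p lam0 lam1 : ℝ) (hlam0 : 0 ≤ lam0) (hlam : lam0 < lam1) (hp0 : 0 < p) (hp1 : p < 1) :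
    ConcaveOn ℝ (Set.Ici (0 : ℝ)) (fun T : ℝ =>
      measureMutualInfo (poissonJointLaw p lam0 lam1
        (fun i => if i.val ≤ 3 then T / 4 else 0)
        (fun i : Fin 4 => (⟨i.val, by omega⟩ : Fin 15)))) := by
  simp only [poissonJointLaw_singlets, implies_true]
  have hconv := convexOn_condEntropy (hlam0.trans hlam.le) hlam0 hp0.le (sub_nonneg.2 hp1.le)
  refine ⟨convex_Ici 0, fun x hx y hy s t hs ht hst => ?_⟩
  have hx0 : (0 : ℝ) ≤ x := hx
  have hy0 : (0 : ℝ) ≤ y := hy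
  have h := hconv.2 (show x / 4 ∈ Set.Ici (0 : ℝ) from div_nonneg hx0 (by norm_num))
    (show y / 4 ∈ Set.Ici (0 : ℝ) from div_nonneg hy0 (by norm_num)) hs ht hst
  simp only [smul_eq_mul] at h ⊢
  rw [measureMutualInfo_singletsLaw hp0 hp1 hlam0 hlam (by positivity),
    measureMutualInfo_singletsLaw hp0 hp1 hlam0 hlam (by positivity),
    measureMutualInfo_singletsLaw hp0 hp1 hlam0 hlam (by positivity),
    show (s * x + t * y) / 4 = s * (x / 4) + t * (y / 4) by ring]
  have hs' : s = 1 - t := by linarith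
  subst hs'
  linarith
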